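/- arXiv:0905.0136 — 6 statements merged into one kernel-verified Lean document; each statement's English description precedes it below -/
import Mathlib

section
/- Let k ≥ 1 and let m_k : ℝ/ℤ → ℝ/ℤ be the k-fold covering map x ↦ k·x. Let G be a group and ρ₀, ρ₁ : G → Homeo⁺(S¹) homomorphisms satisfying ρ₀(g)∘m_k = m_k∘ρ₁(g) for all g ∈ G. Then there exists a function α : G → ℤ with |α(g)| ≤ k+1 for all g ∈ G such that c(ρ₀(g),ρ₀(h)) = k·c(ρ₁(g),ρ₁(h)) + α(gh) − α(g) − α(h) for all g, h ∈ G. -/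
open Filter MeasureTheory Set
open scoped Classical

noncomputable section

/-- The circle `S¹ = ℝ/ℤ`. -/
abbrev S1 : Type := AddCircle (1 : ℝ)

/-- `F : ℝ → ℝ` is an increasing homeomorphism of `ℝ` commuting with integer
translations which is a lift of `f : S¹ → S¹`. -/
def IsCircleLift (f : S1 → S1) (F : ℝ → ℝ) : Prop :=
  StrictMono F ∧ Function.Surjective F ∧ (∀ x, F (x + 1) = F x + 1) ∧
    ∀ x : ℝ, f (x : S1) = (F x : S1)

/-- `f` is an orientation preserving homeomorphism of the circle. -/
def IsOPH (f : S1 → S1) : Prop := ∃ F, IsCircleLift f F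

/-- The unique lift `f̄` of `f ∈ Homeo⁺(S¹)` with `f̄ 0 ∈ [0,1)`. -/
def posLift (f : S1 → S1) : ℝ → ℝ :=
  if h : ∃ F, IsCircleLift f F ∧ F 0 ∈ Set.Ico (0 : ℝ) 1 then h.choose else id

/-- The Euler cocycle `c(f,g)`, defined by `f̄(ḡ(x)) = (f∘g)‾(x) + c(f,g)` where
`f̄` denotes the lift of `f` with `f̄ 0 ∈ [0,1)`. -/
def euler (f g : S1 → S1) : ℝ :=
  posLift f (posLift g 0) - posLift (fun x => f (g x)) 0

/-- A quasi-conjugacy: a self-map of the circle induced by a monotone increasing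
map of `ℝ` commuting with integer translations. -/
def IsQuasiConjMap (h : S1 → S1) : Prop :=
  ∃ H : ℝ → ℝ, Monotone H ∧ (∀ x, H (x + 1) = H x + 1) ∧ ∀ x : ℝ, h (x : S1) = (H x : S1)

/-- `ρ₀` and `ρ₁` are quasi-conjugate: there is a quasi-conjugacy `h` with
`h ∘ ρ₀ γ = ρ₁ γ ∘ h` for all `γ`. -/
def QuasiConj {Γ : Type*} (ρ₀ ρ₁ : Γ → S1 → S1) : Prop :=
  ∃ h, IsQuasiConjMap h ∧ ∀ γ, h ∘ ρ₀ γ = ρ₁ γ ∘ h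

/-- `ρ` is an action of `Γ` on the circle by orientation preserving homeomorphisms,
i.e. a homomorphism `Γ → Homeo⁺(S¹)`. -/
def IsCircleAction (Γ : Type*) [Group Γ] (ρ : Γ → S1 → S1) : Prop :=
  (∀ γ, IsOPH (ρ γ)) ∧ ρ 1 = id ∧ ∀ γ η, ρ (γ * η) = ρ γ ∘ ρ η

theorem S1.coe_eq_coe_iff {x y : ℝ} : (x : S1) = (y : S1) ↔ ∃ n : ℤ, x = y + n := by
  rw [← sub_eq_zero, ← AddCircle.coe_sub, AddCircle.coe_eq_zero_iff]
  simp only [zsmul_eq_mul, mul_one]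
  exact exists_congr fun n => by rw [eq_comm, sub_eq_iff_eq_add']

theorem IsCircleLift.map_add_intCast {f : S1 → S1} {F : ℝ → ℝ} (hF : IsCircleLift f F)
    (x : ℝ) (n : ℤ) : F (x + n) = F x + n := by
  induction n with
  | zero => simp
  | succ n ih =>
    have := hF.2.2.1 (x + (n : ℤ))
    push_cast at *
    rw [← add_assoc, this, ih, add_assoc]
  | pred n ih =>
    have := hF.2.2.1 (x + ((-(n : ℤ) - 1 : ℤ) : ℝ))
    have h : x + ((-(n : ℤ) - 1 : ℤ) : ℝ) + 1 = x + ((-(n : ℤ) : ℤ) : ℝ) := by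
      push_cast; ring
    rw [h, ih] at this
    push_cast at *
    linarith

theorem IsCircleLift.continuous {f : S1 → S1} {F : ℝ → ℝ} (hF : IsCircleLift f F) :
    Continuous F :=
  hF.1.monotone.continuous_of_surjective hF.2.1

theorem IsCircleLift.sub_intCast {f : S1 → S1} {F : ℝ → ℝ} (hF : IsCircleLift f F) (n : ℤ) :
    IsCircleLift f (fun x => F x - n) := by
  refine ⟨fun x y hxy => sub_lt_sub_right (hF.1 hxy) _, fun y => ?_, fun x => ?_, fun x => ?_⟩
  · obtain ⟨x, hx⟩ := hF.2.1 (y + n)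
    exact ⟨x, by simp [hx]⟩
  · simp only [hF.2.2.1 x]
    ring
  · exact (hF.2.2.2 x).trans (S1.coe_eq_coe_iff.2 ⟨n, by ring⟩)

theorem IsOPH.posLift_spec {f : S1 → S1} (hf : IsOPH f) :
    IsCircleLift f (posLift f) ∧ posLift f 0 ∈ Set.Ico (0 : ℝ) 1 := by
  have h : ∃ F, IsCircleLift f F ∧ F 0 ∈ Set.Ico (0 : ℝ) 1 := by
    obtain ⟨F, hF⟩ := hf
    exact ⟨_, hF.sub_intCast ⌊F 0⌋, Int.fract_nonneg (F 0), Int.fract_lt_one (F 0)⟩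
  rw [posLift, dif_pos h]
  exact h.choose_spec

/-- Lifts of two circle maps intertwined by the `k`-fold covering are intertwined by
multiplication by `k`, up to an integer constant. -/
theorem exists_int_lift_covering {k : ℕ} {f₀ f₁ : S1 → S1} {F₀ F₁ : ℝ → ℝ}
    (h₀ : IsCircleLift f₀ F₀) (h₁ : IsCircleLift f₁ F₁)
    (hcov : f₀ ∘ (fun x : S1 => k • x) = (fun x : S1 => k • x) ∘ f₁) :
    ∃ a : ℤ, ∀ x, F₀ (k * x) = k * F₁ x + a := by
  have hint : ∀ x : ℝ, ∃ n : ℤ, F₀ (k * x) = k * F₁ x + n := fun x => by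
    rw [← S1.coe_eq_coe_iff, ← h₀.2.2.2]
    have := congrFun hcov (x : S1)
    simp only [Function.comp_apply, h₁.2.2.2, ← AddCircle.coe_nsmul, nsmul_eq_mul] at this
    exact this
  choose n hn using hint
  have hcont : Continuous n := by
    rw [Int.isClosedEmbedding_coe_real.isEmbedding.continuous_iff]
    have : ((↑) : ℤ → ℝ) ∘ n = fun x => F₀ (k * x) - k * F₁ x :=
      funext fun x => by simp [hn]
    rw [this]
    have := h₀.continuous
    have := h₁.continuous
    fun_prop
  exact ⟨n 0, fun x => by
    rw [hn x, PreconnectedSpace.constant inferInstance hcont (x := x) (y := 0)]⟩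

/-- If `ρ₀, ρ₁ : G → Homeo⁺(S¹)` are homomorphisms intertwined by the `k`-fold
covering map `m_k : x ↦ k·x`, then the Euler cocycle of `ρ₀` differs from `k` times
the Euler cocycle of `ρ₁` by the coboundary of a function `α : G → ℤ` bounded by
`k + 1`. -/
theorem euler_cocycle_of_covering_factor
    {G : Type*} [Group G] (k : ℕ) (hk : 1 ≤ k)
    (ρ₀ ρ₁ : G → S1 → S1) (h₀ : IsCircleAction G ρ₀) (h₁ : IsCircleAction G ρ₁)
    (hcov : ∀ g : G, ρ₀ g ∘ (fun x : S1 => k • x) = (fun x : S1 => k • x) ∘ ρ₁ g) :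
    ∃ α : G → ℤ, (∀ g : G, |α g| ≤ (k : ℤ) + 1) ∧
      ∀ g h : G, euler (ρ₀ g) (ρ₀ h) =
        (k : ℝ) * euler (ρ₁ g) (ρ₁ h) + (α (g * h) : ℝ) - (α g : ℝ) - (α h : ℝ) := by
  have L₀ := fun g => (h₀.1 g).posLift_spec
  have L₁ := fun g => (h₁.1 g).posLift_spec
  choose a ha using fun g => exists_int_lift_covering (L₀ g).1 (L₁ g).1 (hcov g)
  have ha_zero : ∀ g, posLift (ρ₀ g) 0 = k * posLift (ρ₁ g) 0 + a g := fun g => by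
    simpa using ha g 0
  refine ⟨fun g => -a g, fun g => ?_, fun g h => ?_⟩
  · obtain ⟨l₀, u₀⟩ := (L₀ g).2
    obtain ⟨l₁, u₁⟩ := (L₁ g).2
    have hk' : (1 : ℝ) ≤ k := by exact_mod_cast hk
    have hg := ha_zero g
    rw [abs_neg, abs_le]
    constructor
    · have : -((k : ℝ) + 1) ≤ a g := by nlinarith
      exact_mod_cast this
    · have : (a g : ℝ) ≤ k + 1 := by nlinarith
      exact_mod_cast this
  · have e₀ : (fun x => ρ₀ g (ρ₀ h x)) = ρ₀ (g * h) := (h₀.2.2 g h).symm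
    have e₁ : (fun x => ρ₁ g (ρ₁ h x)) = ρ₁ (g * h) := (h₁.2.2 g h).symm
    rw [euler, euler, e₀, e₁, ha_zero (g * h), ha_zero h, (L₀ g).1.map_add_intCast, ha g]
    push_cast
    ring

end
end

section
/- Let X be a set and ω : X³ → ℝ a strict alternating cocycle taking values in [−1,1]: ω(x_{σ(1)},x_{σ(2)},x_{σ(3)}) = sign(σ)·ω(x₁,x₂,x₃) for every permutation σ of {1,2,3}, and ω(y,z,w) − ω(x,z,w) + ω(x,y,w) − ω(x,y,z) = 0 for all x,y,z,w ∈ X, with |ω(x,y,z)| ≤ 1 everywhere. For a,c ∈ X set I(a,c) = {z ∈ X : ω(a,z,c) = 1}. Then for all a,c ∈ X and every b ∈ I(a,c): I(a,b) ∪ I(b,c) ⊆ I(a,c) and I(a,b) ∩ I(b,c) = ∅. -/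
/-- Let `ω : X³ → ℝ` be a strict alternating cocycle with values in `[-1,1]`, and for
`a, c ∈ X` let `I(a,c) = {z : ω(a,z,c) = 1}`.  Then for all `a, c` and all
`b ∈ I(a,c)` one has `I(a,b) ∪ I(b,c) ⊆ I(a,c)` and `I(a,b) ∩ I(b,c) = ∅`. -/
theorem cocycle_interval_union_subset_and_disjoint
    {X : Type*} (ω : X → X → X → ℝ)
    (halt : ∀ (σ : Equiv.Perm (Fin 3)) (v : Fin 3 → X),
      ω (v (σ 0)) (v (σ 1)) (v (σ 2)) =
        ((Equiv.Perm.sign σ : ℤ) : ℝ) * ω (v 0) (v 1) (v 2))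
    (hcoc : ∀ x y z w : X, ω y z w - ω x z w + ω x y w - ω x y z = 0)
    (hbdd : ∀ x y z : X, |ω x y z| ≤ 1) :
    ∀ a c b : X, ω a b c = 1 →
      ({z : X | ω a z b = 1} ∪ {z : X | ω b z c = 1} ⊆ {z : X | ω a z c = 1}) ∧
      ({z : X | ω a z b = 1} ∩ {z : X | ω b z c = 1} = ∅) := by
  intro a c b hb
  have hswap (x y z : X) : ω y x z = -ω x y z := by
    have h := halt (Equiv.swap 0 1) ![x, y, z]
    rw [Equiv.Perm.sign_swap (by decide), Equiv.swap_apply_left, Equiv.swap_apply_right,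
      Equiv.swap_apply_of_ne_of_ne (by decide) (by decide)] at h
    simpa using h
  have hle (x y z : X) : ω x y z ≤ 1 := (abs_le.mp (hbdd x y z)).2
  refine ⟨?_, ?_⟩
  · rintro z (hz | hz) <;> simp only [Set.mem_ofPred_eq] at hz ⊢
    · linarith [hcoc a z b c, hle z b c, hle a z c]
    · linarith [hcoc a b z c, hle a b z, hle a z c]
  · rw [Set.eq_empty_iff_forall_notMem]
    rintro z ⟨hz, hz'⟩
    simp only [Set.mem_ofPred_eq] at hz hz'
    linarith [hcoc a z b c, hle a z c, hswap b z c]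
end

section
/- Let ξ be an atomless Borel probability measure on S¹ = ℝ/ℤ and define h_ξ : S¹ → S¹ by h_ξ(x) = ξ([0̇,x)) mod ℤ, where [0̇,x) denotes the positively oriented half-open arc from the basepoint 0̇ (the image of 0) to x, with [0̇,0̇) = ∅. Then: (1) h_ξ is continuous; (2) the pushforward measure (h_ξ)_*ξ is atomless and its support is all of S¹; (3) for ξ³-almost every (x,y,z) ∈ (S¹)³, o(h_ξ(x),h_ξ(y),h_ξ(z)) = o(x,y,z). -/
open Filter MeasureTheory Set
open scoped Classical

noncomputable section

/-- `(x,y,z)` is a positively oriented triple of pairwise distinct points on the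
circle. -/
def PosOriented (x y z : S1) : Prop :=
  ∃ a b c : ℝ, (a : S1) = x ∧ (b : S1) = y ∧ (c : S1) = z ∧ a < b ∧ b < c ∧ c < a + 1

/-- The orientation cocycle `o : (S¹)³ → {-1,0,1}`. -/
def orient (x y z : S1) : ℝ :=
  if PosOriented x y z then 1 else if PosOriented z y x then -1 else 0

/-- The canonical representative of a point of `S¹` in `[0,1)`. -/
def rep (y : S1) : ℝ := (AddCircle.equivIco 1 0 y : ℝ)

/-- The positively oriented half-open arc `[0̇, x)` from the basepoint `0̇` to `x`
(empty when `x = 0̇`). -/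
def arcFromZero (x : S1) : Set S1 := {y : S1 | rep y < rep x}

/-- The map `h_ξ : S¹ → S¹`, `h_ξ(x) = ξ([0̇,x)) mod ℤ`. -/
def quasiConjOfMeasure (ξ : Measure S1) (x : S1) : S1 :=
  (((ξ (arcFromZero x)).toReal : ℝ) : S1)

/-- The support of a measure: the set of points all of whose neighbourhoods have
positive measure. -/
def measSupport {α : Type*} [TopologicalSpace α] [MeasurableSpace α]
    (μ : Measure α) : Set α :=
  {x | ∀ U ∈ nhds x, 0 < μ U}

/-- The cumulative distribution function of an atomless probability measure is continuous. -/
lemma continuous_cdf_of_nullSingletonClass (ν : Measure ℝ) [IsProbabilityMeasure ν] [NullSingletonClass ν] :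
    Continuous (ProbabilityTheory.cdf ν) := by
  rw [continuous_iff_continuousAt]
  intro t
  have hmono := ProbabilityTheory.monotone_cdf ν
  rw [hmono.continuousAt_iff_leftLim_eq_rightLim, StieltjesFunction.rightLim_eq]
  refine le_antisymm (hmono.leftLim_le le_rfl) ?_
  have h := (ProbabilityTheory.cdf ν).measure_singleton t
  rw [ProbabilityTheory.measure_cdf, measure_singleton] at h
  have := ENNReal.ofReal_eq_zero.1 h.symm
  linarith

/-- Probability integral transform: an atomless probability measure is transported to the uniform
distribution on the unit interval by its cumulative distribution function. -/
lemma map_cdf_of_nullSingletonClass (ν : Measure ℝ) [IsProbabilityMeasure ν] [NullSingletonClass ν] :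
    ν.map (ProbabilityTheory.cdf ν) = volume.restrict (Ioc 0 1) := by
  have hcont := continuous_cdf_of_nullSingletonClass ν
  have hmono := ProbabilityTheory.monotone_cdf ν
  have : IsProbabilityMeasure (ν.map (ProbabilityTheory.cdf ν)) :=
    Measure.isProbabilityMeasure_map hcont.measurable.aemeasurable
  have hivt : ∀ s ∈ Ioo (0 : ℝ) 1, ∃ t, ProbabilityTheory.cdf ν t = s := by
    intro s hs
    obtain ⟨a, ha⟩ :=
      ((ProbabilityTheory.tendsto_cdf_atBot ν).eventually_le_const hs.1).exists
    obtain ⟨b, hb⟩ :=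
      ((ProbabilityTheory.tendsto_cdf_atTop ν).eventually_const_le hs.2).exists
    exact mem_range_of_exists_le_of_exists_ge hcont ⟨a, ha⟩ ⟨b, hb⟩
  have hlower : ∀ s ∈ Ioo (0 : ℝ) 1, s ≤ ν.real {u | ProbabilityTheory.cdf ν u ≤ s} := by
    intro s hs
    obtain ⟨t, rfl⟩ := hivt s hs
    nth_rw 1 [ProbabilityTheory.cdf_eq_real]
    exact measureReal_mono fun u hu => hmono hu
  have hlt : ∀ s, ∀ r ∈ Ioo (0 : ℝ) 1, s < r →
      ν.real {u | ProbabilityTheory.cdf ν u ≤ s} ≤ r := by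
    intro s r hr hsr
    obtain ⟨t, rfl⟩ := hivt r hr
    rw [ProbabilityTheory.cdf_eq_real ν t]
    refine measureReal_mono fun u hu => ?_
    exact (hmono.reflect_lt (lt_of_le_of_lt hu hsr)).le
  refine Measure.ext_of_Iic _ _ fun s => ?_
  rw [Measure.map_apply hcont.measurable measurableSet_Iic,
    Measure.restrict_apply measurableSet_Iic, inter_comm, Ioc_inter_Iic, Real.volume_Ioc, sub_zero]
  change ν {u | ProbabilityTheory.cdf ν u ≤ s} = ENNReal.ofReal (min 1 s)
  rcases le_or_gt 1 s with h1 | h1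
  · have huniv : {u | ProbabilityTheory.cdf ν u ≤ s} = univ :=
      eq_univ_of_forall fun u => (ProbabilityTheory.cdf_le_one ν u).trans h1
    simp [huniv, h1]
  · rw [min_eq_right h1.le, ← ofReal_measureReal (by finiteness)]
    have hupper : ν.real {u | ProbabilityTheory.cdf ν u ≤ s} ≤ max s 0 := by
      refine le_of_forall_gt_imp_ge_of_dense fun r hr => ?_
      rcases lt_or_ge r 1 with hr1 | hr1
      · exact hlt s r ⟨(le_max_right _ _).trans_lt hr, hr1⟩ ((le_max_left _ _).trans_lt hr)
      · exact measureReal_le_one.trans hr1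
    rcases le_or_gt s 0 with h0 | h0
    · rw [max_eq_right h0] at hupper
      rw [ENNReal.ofReal_of_nonpos hupper, ENNReal.ofReal_of_nonpos h0]
    · rw [max_eq_left h0.le] at hupper
      rw [le_antisymm hupper (hlower s ⟨h0, h1⟩)]

lemma rep_nonneg (x : S1) : 0 ≤ rep x := (AddCircle.equivIco 1 0 x).2.1

lemma rep_lt_one (x : S1) : rep x < 1 :=
  (AddCircle.equivIco 1 0 x).2.2.trans_eq (zero_add 1)

lemma coe_rep (x : S1) : ((rep x : ℝ) : S1) = x := AddCircle.coe_equivIco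

lemma rep_coe {t : ℝ} (h0 : 0 ≤ t) (h1 : t < 1) : rep (t : S1) = t := by
  simp [rep, AddCircle.equivIco_coe_eq (p := (1 : ℝ)) (a := 0) (x := t) ⟨h0, by simpa using h1⟩]

lemma measurable_rep : Measurable rep :=
  measurable_subtype_coe.comp (AddCircle.measurableEquivIco (1 : ℝ) 0).measurable

lemma volume_singleton_eq_zero (c : S1) : volume {c} = 0 := by
  rw [← Metric.closedBall_zero, AddCircle.volume_closedBall]
  simp

lemma exists_eq_rep_add_int (a : ℝ) : ∃ m : ℤ, a = rep (a : S1) + m := by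
  obtain ⟨m, hm⟩ := (QuotientAddGroup.eq_iff_sub_mem.1 (coe_rep (a : S1)).symm)
  refine ⟨m, ?_⟩
  simp only [zsmul_eq_mul, mul_one] at hm
  linarith

lemma posOriented_iff (x y z : S1) : PosOriented x y z ↔
    (rep x < rep y ∧ rep y < rep z) ∨ (rep y < rep z ∧ rep z < rep x) ∨
      (rep z < rep x ∧ rep x < rep y) := by
  have hx := rep_nonneg x
  have hy := rep_nonneg y
  have hz := rep_nonneg z
  have hx' := rep_lt_one x
  have hy' := rep_lt_one y
  have hz' := rep_lt_one z
  have hadd : ∀ w : S1, ((rep w + 1 : ℝ) : S1) = w := fun w => by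
    rw [AddCircle.coe_add_period, coe_rep]
  constructor
  · rintro ⟨a, b, c, rfl, rfl, rfl, hab, hbc, hca⟩
    obtain ⟨m, hm⟩ := exists_eq_rep_add_int a
    obtain ⟨n, hn⟩ := exists_eq_rep_add_int b
    obtain ⟨k, hk⟩ := exists_eq_rep_add_int c
    have hmn : m ≤ n := by
      have : (m : ℝ) < n + 1 := by linarith
      exact Int.lt_add_one_iff.1 (by exact_mod_cast this)
    have hnk : n ≤ k := by
      have : (n : ℝ) < k + 1 := by linarith
      exact Int.lt_add_one_iff.1 (by exact_mod_cast this)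
    have hkm : k ≤ m + 1 := by
      have : (k : ℝ) < m + 1 + 1 := by linarith
      exact Int.lt_add_one_iff.1 (by exact_mod_cast this)
    obtain rfl | rfl : n = m ∨ n = m + 1 := by omega
    · obtain rfl | rfl : k = n ∨ k = n + 1 := by omega
      · exact Or.inl ⟨by linarith, by linarith⟩
      · push_cast at hk
        exact Or.inr (Or.inr ⟨by linarith, by linarith⟩)
    · obtain rfl : k = m + 1 := by omega
      push_cast at hn hk
      exact Or.inr (Or.inl ⟨by linarith, by linarith⟩)
  · rintro (⟨h1, h2⟩ | ⟨h1, h2⟩ | ⟨h1, h2⟩)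
    · exact ⟨rep x, rep y, rep z, coe_rep x, coe_rep y, coe_rep z, h1, h2, by linarith⟩
    · exact ⟨rep x, rep y + 1, rep z + 1, coe_rep x, hadd y, hadd z, by linarith, by linarith,
        by linarith⟩
    · exact ⟨rep x, rep y, rep z + 1, coe_rep x, coe_rep y, hadd z, by linarith, by linarith,
        by linarith⟩

/-- The cumulative distribution function of a measure on the circle, in the coordinate `rep`. -/
def circleCdf (ξ : Measure S1) : ℝ → ℝ := ProbabilityTheory.cdf (ξ.map rep)

section

variable (ξ : Measure S1)

lemma isProbabilityMeasure_map_rep [IsProbabilityMeasure ξ] : IsProbabilityMeasure (ξ.map rep) :=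
  Measure.isProbabilityMeasure_map measurable_rep.aemeasurable

lemma nullSingletonClass_map_rep (hatomless : ∀ x : S1, ξ {x} = 0) :
    NullSingletonClass (ξ.map rep) where
  measure_singleton t := by
    rw [Measure.map_apply measurable_rep (measurableSet_singleton t)]
    refine measure_mono_null ?_ (hatomless (t : S1))
    rintro y rfl
    exact (coe_rep y).symm

variable [IsProbabilityMeasure ξ]

lemma quasiConjOfMeasure_eq_coe (hatomless : ∀ x : S1, ξ {x} = 0) (x : S1) :
    quasiConjOfMeasure ξ x = (circleCdf ξ (rep x) : S1) := by
  have := isProbabilityMeasure_map_rep ξ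
  have := nullSingletonClass_map_rep ξ hatomless
  have h : circleCdf ξ (rep x) = ξ.real (arcFromZero x) := by
    rw [circleCdf, ProbabilityTheory.cdf_eq_real, ← measureReal_congr Iio_ae_eq_Iic,
      map_measureReal_apply measurable_rep measurableSet_Iio]
    rfl
  rw [h]
  rfl

lemma continuous_circleCdf (hatomless : ∀ x : S1, ξ {x} = 0) : Continuous (circleCdf ξ) := by
  have := isProbabilityMeasure_map_rep ξ
  have := nullSingletonClass_map_rep ξ hatomless
  exact continuous_cdf_of_nullSingletonClass _

lemma circleCdf_zero (hatomless : ∀ x : S1, ξ {x} = 0) : circleCdf ξ 0 = 0 := by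
  have := isProbabilityMeasure_map_rep ξ
  have := nullSingletonClass_map_rep ξ hatomless
  have hempty : rep ⁻¹' Iio 0 = ∅ := eq_empty_of_forall_notMem fun y hy =>
    absurd (rep_nonneg y) (not_le.2 hy)
  rw [circleCdf, ProbabilityTheory.cdf_eq_real, ← measureReal_congr Iio_ae_eq_Iic,
    map_measureReal_apply measurable_rep measurableSet_Iio, hempty, measureReal_empty]

lemma circleCdf_one : circleCdf ξ 1 = 1 := by
  have := isProbabilityMeasure_map_rep ξ
  have huniv : rep ⁻¹' Iic 1 = univ := eq_univ_of_forall fun y => (rep_lt_one y).le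
  rw [circleCdf, ProbabilityTheory.cdf_eq_real,
    map_measureReal_apply measurable_rep measurableSet_Iic, huniv, probReal_univ]

lemma continuous_quasiConjOfMeasure (hatomless : ∀ x : S1, ξ {x} = 0) :
    Continuous (quasiConjOfMeasure ξ) := by
  have h : quasiConjOfMeasure ξ =
      AddCircle.liftIco 1 0 (fun t => ((circleCdf ξ t : ℝ) : S1)) :=
    funext (quasiConjOfMeasure_eq_coe ξ hatomless)
  rw [h]
  refine AddCircle.liftIco_continuous ?_ ?_
  · have h1 : ((1 : ℝ) : S1) = 0 := AddCircle.coe_period 1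
    simp [circleCdf_zero ξ hatomless, circleCdf_one ξ, h1]
  · exact ((AddCircle.continuous_mk' 1).comp (continuous_circleCdf ξ hatomless)).continuousOn

/-- The map `h_ξ` transports `ξ` to the Haar measure of the circle. -/
lemma map_quasiConjOfMeasure (hatomless : ∀ x : S1, ξ {x} = 0) :
    ξ.map (quasiConjOfMeasure ξ) = volume := by
  have := isProbabilityMeasure_map_rep ξ
  have := nullSingletonClass_map_rep ξ hatomless
  have hcont := continuous_circleCdf ξ hatomless
  have hmk := AddCircle.measurePreserving_mk (1 : ℝ) 0
  have h : quasiConjOfMeasure ξ = (fun t : ℝ => (t : S1)) ∘ circleCdf ξ ∘ rep :=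
    funext (quasiConjOfMeasure_eq_coe ξ hatomless)
  rw [h, ← Measure.map_map hmk.measurable (hcont.measurable.comp measurable_rep),
    ← Measure.map_map hcont.measurable measurable_rep, circleCdf,
    map_cdf_of_nullSingletonClass]
  simpa using hmk.map_eq

/-- The fibres of `h_ξ` are `ξ`-null. -/
lemma ae_quasiConjOfMeasure_ne (hatomless : ∀ x : S1, ξ {x} = 0) (c : S1) :
    ∀ᵐ x ∂ξ, c ≠ quasiConjOfMeasure ξ x := by
  have hmeas := (continuous_quasiConjOfMeasure ξ hatomless).measurable
  have hc : ξ (quasiConjOfMeasure ξ ⁻¹' {c}) = 0 := by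
    rw [← Measure.map_apply hmeas (measurableSet_singleton c),
      map_quasiConjOfMeasure ξ hatomless]
    exact volume_singleton_eq_zero c
  filter_upwards [measure_eq_zero_iff_ae_notMem.1 hc] with x hx h
  exact hx h.symm

/-- Away from the fibre over the basepoint, `h_ξ` is order preserving in the coordinate `rep`
on points with distinct images. -/
lemma rep_quasiConjOfMeasure_lt_iff (hatomless : ∀ x : S1, ξ {x} = 0) {x y : S1}
    (hx : 0 ≠ quasiConjOfMeasure ξ x) (hy : 0 ≠ quasiConjOfMeasure ξ y)
    (hxy : quasiConjOfMeasure ξ x ≠ quasiConjOfMeasure ξ y) :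
    rep (quasiConjOfMeasure ξ x) < rep (quasiConjOfMeasure ξ y) ↔ rep x < rep y := by
  have hmono : Monotone (circleCdf ξ) := ProbabilityTheory.monotone_cdf _
  have hrep : ∀ w : S1, 0 ≠ quasiConjOfMeasure ξ w →
      rep (quasiConjOfMeasure ξ w) = circleCdf ξ (rep w) := by
    intro w hw
    rw [quasiConjOfMeasure_eq_coe ξ hatomless] at hw ⊢
    refine rep_coe (ProbabilityTheory.cdf_nonneg _ _)
      (lt_of_le_of_ne (ProbabilityTheory.cdf_le_one _ _) fun h => hw ?_)
    change circleCdf ξ (rep w) = 1 at h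
    rw [h]
    exact (AddCircle.coe_period 1).symm
  rw [hrep x hx, hrep y hy]
  refine ⟨fun h => hmono.reflect_lt h, fun h => lt_of_le_of_ne (hmono h.le) fun he => hxy ?_⟩
  rw [quasiConjOfMeasure_eq_coe ξ hatomless, quasiConjOfMeasure_eq_coe ξ hatomless, he]

lemma ae_orient_quasiConjOfMeasure (hatomless : ∀ x : S1, ξ {x} = 0) :
    ∀ᵐ p : S1 × S1 × S1 ∂(ξ.prod (ξ.prod ξ)),
      orient (quasiConjOfMeasure ξ p.1) (quasiConjOfMeasure ξ p.2.1)
          (quasiConjOfMeasure ξ p.2.2) = orient p.1 p.2.1 p.2.2 := by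
  have hmeas := (continuous_quasiConjOfMeasure ξ hatomless).measurable
  have hne := ae_quasiConjOfMeasure_ne ξ hatomless
  have hpair : ∀ᵐ q : S1 × S1 ∂(ξ.prod ξ), quasiConjOfMeasure ξ q.1 ≠ quasiConjOfMeasure ξ q.2 :=
    (Measure.ae_prod_iff_ae_ae (measurableSet_eq_fun (hmeas.comp measurable_fst)
      (hmeas.comp measurable_snd)).compl).2 (ae_of_all _ fun x => hne (quasiConjOfMeasure ξ x))
  have h12 : ∀ᵐ p : S1 × S1 × S1 ∂(ξ.prod (ξ.prod ξ)),
      quasiConjOfMeasure ξ p.1 ≠ quasiConjOfMeasure ξ p.2.1 :=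
    (Measure.ae_prod_iff_ae_ae (measurableSet_eq_fun (hmeas.comp measurable_fst)
      (hmeas.comp measurable_snd.fst)).compl).2
      (ae_of_all _ fun x => Measure.quasiMeasurePreserving_fst.ae (hne (quasiConjOfMeasure ξ x)))
  have h13 : ∀ᵐ p : S1 × S1 × S1 ∂(ξ.prod (ξ.prod ξ)),
      quasiConjOfMeasure ξ p.1 ≠ quasiConjOfMeasure ξ p.2.2 :=
    (Measure.ae_prod_iff_ae_ae (measurableSet_eq_fun (hmeas.comp measurable_fst)
      (hmeas.comp measurable_snd.snd)).compl).2
      (ae_of_all _ fun x => Measure.quasiMeasurePreserving_snd.ae (hne (quasiConjOfMeasure ξ x)))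
  have hsnd := Measure.quasiMeasurePreserving_snd (μ := ξ) (ν := ξ.prod ξ)
  filter_upwards [h12, h13, hsnd.ae hpair, Measure.quasiMeasurePreserving_fst.ae (hne 0),
    hsnd.ae (Measure.quasiMeasurePreserving_fst.ae (hne 0)),
    hsnd.ae (Measure.quasiMeasurePreserving_snd.ae (hne 0))] with p h12 h13 h23 h1 h2 h3
  simp only [orient, posOriented_iff,
    rep_quasiConjOfMeasure_lt_iff ξ hatomless h1 h2 h12,
    rep_quasiConjOfMeasure_lt_iff ξ hatomless h2 h1 h12.symm,
    rep_quasiConjOfMeasure_lt_iff ξ hatomless h1 h3 h13,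
    rep_quasiConjOfMeasure_lt_iff ξ hatomless h3 h1 h13.symm,
    rep_quasiConjOfMeasure_lt_iff ξ hatomless h2 h3 h23,
    rep_quasiConjOfMeasure_lt_iff ξ hatomless h3 h2 h23.symm]

end

/-- For an atomless Borel probability measure `ξ` on `S¹`, the map
`h_ξ(x) = ξ([0̇,x))` is continuous, its pushforward `(h_ξ)_*ξ` is atomless with full
support, and `h_ξ` preserves the orientation cocycle `ξ³`-almost everywhere. -/
theorem quasiConjOfMeasure_props
    (ξ : Measure S1) [IsProbabilityMeasure ξ] (hatomless : ∀ x : S1, ξ {x} = 0) :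
    Continuous (quasiConjOfMeasure ξ) ∧
    (∀ x : S1, Measure.map (quasiConjOfMeasure ξ) ξ {x} = 0) ∧
    measSupport (Measure.map (quasiConjOfMeasure ξ) ξ) = Set.univ ∧
    (∀ᵐ p : S1 × S1 × S1 ∂(ξ.prod (ξ.prod ξ)),
      orient (quasiConjOfMeasure ξ p.1) (quasiConjOfMeasure ξ p.2.1)
          (quasiConjOfMeasure ξ p.2.2) = orient p.1 p.2.1 p.2.2) := by
  refine ⟨continuous_quasiConjOfMeasure ξ hatomless, fun x => ?_, ?_,
    ae_orient_quasiConjOfMeasure ξ hatomless⟩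
  · rw [map_quasiConjOfMeasure ξ hatomless]
    exact volume_singleton_eq_zero x
  · rw [map_quasiConjOfMeasure ξ hatomless]
    exact eq_univ_of_forall fun x U hU => Measure.measure_pos_of_mem_nhds _ hU

end
end

section
/- Let (B,ν) be a probability space and let φ, ψ : B → S¹ be measurable maps such that: (i) the pushforward measures φ_*ν and ψ_*ν are atomless; (ii) the supports of φ_*ν and of ψ_*ν are all of S¹; (iii) o(φ(x),φ(y),φ(z)) = o(ψ(x),ψ(y),ψ(z)) for ν³-almost every (x,y,z) ∈ B³. Then there exists an orientation-preserving homeomorphism h ∈ Homeo⁺(S¹) such that h(φ(x)) = ψ(x) for ν-almost every x ∈ B; moreover the support of the pushforward of ν under x ↦ (φ(x),ψ(x)) equals the graph of h in S¹ × S¹. -/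
open Filter MeasureTheory Set
open scoped Classical

noncomputable section

/-- The coordinate in `[0, 1)` of `u : S¹` along the positive arc starting at `a`. -/
def arcCoord (a : ℝ) (u : S1) : ℝ := (AddCircle.equivIco (1 : ℝ) 0 (u - (a : S1)) : ℝ)

lemma arcCoord_mem (a : ℝ) (u : S1) : arcCoord a u ∈ Ico (0 : ℝ) 1 := by
  have h := (AddCircle.equivIco (1 : ℝ) 0 (u - (a : S1))).2
  exact ⟨h.1, h.2.trans_eq (zero_add 1)⟩

lemma coe_add_arcCoord (a : ℝ) (u : S1) : ((a + arcCoord a u : ℝ) : S1) = u := by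
  rw [AddCircle.coe_add, arcCoord, AddCircle.coe_equivIco]
  abel

lemma arcCoord_coe_add (a : ℝ) {r : ℝ} (hr : r ∈ Ico (0 : ℝ) 1) :
    arcCoord a ((a + r : ℝ) : S1) = r := by
  rw [arcCoord, AddCircle.coe_add, add_sub_cancel_left]
  exact AddCircle.equivIco_coe_of_mem (by rwa [zero_add])

lemma measurable_arcCoord (a : ℝ) : Measurable (arcCoord a) :=
  measurable_subtype_coe.comp
    ((AddCircle.measurableEquivIco (1 : ℝ) 0).measurable.comp (measurable_id.sub_const _))

lemma posOriented_coe_iff (a : ℝ) (u v : S1) :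
    PosOriented a u v ↔ 0 < arcCoord a u ∧ arcCoord a u < arcCoord a v := by
  constructor
  · rintro ⟨a', b, c, ha, rfl, rfl, hab, hbc, hca⟩
    have key : ∀ t : ℝ, (t : S1) = ((a + (t - a') : ℝ) : S1) := by
      intro t
      rw [AddCircle.coe_add, AddCircle.coe_sub, ha]
      abel
    rw [key b, key c, arcCoord_coe_add a ⟨by linarith, by linarith⟩,
      arcCoord_coe_add a ⟨by linarith, by linarith⟩]
    constructor <;> linarith
  · rintro ⟨h0, h1⟩
    exact ⟨a, a + arcCoord a u, a + arcCoord a v, rfl, coe_add_arcCoord a u,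
      coe_add_arcCoord a v, by linarith, by linarith, by linarith [(arcCoord_mem a v).2]⟩

lemma orient_eq_one_iff (x y z : S1) : orient x y z = 1 ↔ PosOriented x y z := by
  unfold orient
  split_ifs <;> norm_num [*]

lemma measure_pos_of_isOpen {α : Type*} [TopologicalSpace α] [MeasurableSpace α]
    {μ : Measure α} (hμ : measSupport μ = univ) {U : Set α} (hU : IsOpen U)
    (hne : U.Nonempty) : 0 < μ U := by
  obtain ⟨x, hx⟩ := hne
  have h : x ∈ measSupport μ := hμ ▸ mem_univ x
  exact h U (hU.mem_nhds hx)

lemma map_arcCoord_singleton {μ : Measure S1} (hμ : ∀ x, μ {x} = 0) (a t : ℝ) :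
    μ.map (arcCoord a) {t} = 0 := by
  rw [Measure.map_apply (measurable_arcCoord a) (measurableSet_singleton t)]
  refine measure_mono_null (t := {((a + t : ℝ) : S1)}) ?_ (hμ _)
  intro u hu
  rw [mem_preimage, mem_singleton_iff] at hu
  rw [mem_singleton_iff, ← hu, coe_add_arcCoord]

lemma map_arcCoord_Ioo_pos {μ : Measure S1} (hμ : measSupport μ = univ) (a : ℝ) {s t : ℝ}
    (hs : 0 ≤ s) (hst : s < t) (ht : t ≤ 1) : 0 < μ.map (arcCoord a) (Ioo s t) := by
  rw [Measure.map_apply (measurable_arcCoord a) measurableSet_Ioo]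
  have hopen : IsOpen ((fun r : ℝ => (r : S1)) '' Ioo (a + s) (a + t)) :=
    QuotientAddGroup.isOpenMap_coe _ isOpen_Ioo
  refine (measure_pos_of_isOpen hμ hopen ((nonempty_Ioo.2 (by linarith)).image _)).trans_le
    (measure_mono ?_)
  rintro _ ⟨r, hr, rfl⟩
  have h : arcCoord a (r : S1) = r - a := by
    have := arcCoord_coe_add a (r := r - a) ⟨by linarith [hr.1], by linarith [hr.2]⟩
    rwa [add_sub_cancel] at this
  change arcCoord a (r : S1) ∈ Ioo s t
  rw [h]
  exact ⟨by linarith [hr.1], by linarith [hr.2]⟩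

open ProbabilityTheory in
lemma continuous_cdf {P : Measure ℝ} [IsProbabilityMeasure P] (hP : ∀ x, P {x} = 0) :
    Continuous (cdf P) := by
  refine continuous_iff_continuousAt.2 fun x => ?_
  rw [(monotone_cdf P).continuousAt_iff_leftLim_eq_rightLim, StieltjesFunction.rightLim_eq]
  have h := (cdf P).measure_singleton x
  rw [measure_cdf, hP, eq_comm, ENNReal.ofReal_eq_zero] at h
  exact le_antisymm ((monotone_cdf P).leftLim_le le_rfl) (by linarith)

open ProbabilityTheory in
/-- The distribution function of an atomless law of full support on `[0, 1)` extends to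
an increasing homeomorphism of `ℝ` commuting with integer translations. -/
lemma exists_periodic_extension_cdf {P : Measure ℝ} [IsProbabilityMeasure P]
    (hatom : ∀ x, P {x} = 0) (hmem : ∀ᵐ x ∂P, x ∈ Ico (0 : ℝ) 1)
    (hpos : ∀ s t, 0 ≤ s → s < t → t ≤ 1 → 0 < P (Ioo s t)) :
    ∃ C : ℝ → ℝ, StrictMono C ∧ Function.Surjective C ∧ (∀ x, C (x + 1) = C x + 1) ∧
      ∀ x ∈ Ico (0 : ℝ) 1, C x = cdf P x := by
  have hc := continuous_cdf hatom
  have hc0 : cdf P 0 = 0 := by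
    rw [cdf_eq_real, measureReal_eq_zero_iff, ← Iio_union_right]
    refine measure_union_null (measure_mono_null ?_ (ae_iff.1 hmem)) (hatom 0)
    intro x hx h
    exact absurd h.1 (not_le.2 hx)
  have hc1 : cdf P 1 = 1 := by
    rw [cdf_eq_real]
    refine (measureReal_congr (t := univ) ?_).trans probReal_univ
    filter_upwards [hmem] with x hx
    exact propext ⟨fun _ => trivial, fun _ => hx.2.le⟩
  have hlt : ∀ s t, 0 ≤ s → s < t → t ≤ 1 → cdf P s < cdf P t := by
    intro s t hs hst ht
    have h := hpos s t hs hst ht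
    have h' := (cdf P).measure_Ioc s t
    rw [measure_cdf] at h'
    have := h.trans_le (measure_mono Ioo_subset_Ioc_self)
    rw [h', ENNReal.ofReal_pos] at this
    linarith
  have hcont : Continuous fun x : ℝ => x + (cdf P (Int.fract x) - Int.fract x) := by
    refine continuous_id.add (ContinuousOn.comp_fract'' (f := fun x => cdf P x - x)
      (hc.sub continuous_id).continuousOn ?_)
    simp [hc0, hc1]
  have hbound : ∀ x : ℝ, 0 ≤ cdf P (Int.fract x) ∧ cdf P (Int.fract x) ≤ 1 := fun x =>
    ⟨cdf_nonneg P _, cdf_le_one P _⟩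
  refine ⟨fun x => x + (cdf P (Int.fract x) - Int.fract x), ?_, ?_, ?_, ?_⟩
  · intro s t hst
    have hs := Int.floor_add_fract s
    have ht := Int.floor_add_fract t
    rcases (Int.floor_mono hst.le).lt_or_eq with h | h
    · have h1 := hlt _ _ (Int.fract_nonneg s) (Int.fract_lt_one s) le_rfl
      have h2 : (⌊s⌋ : ℝ) + 1 ≤ ⌊t⌋ := by exact_mod_cast h
      have h3 := (hbound t).1
      simp only
      linarith
    · have h0 : (⌊s⌋ : ℝ) = ⌊t⌋ := by exact_mod_cast h
      have h1 := hlt _ _ (Int.fract_nonneg s) (by linarith) (Int.fract_lt_one t).le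
      simp only
      linarith
  · refine hcont.surjective ?_ ?_
    · refine tendsto_atTop_mono (fun x => ?_) (tendsto_atTop_add_const_right _ (-1 : ℝ) tendsto_id)
      have := (hbound x).1
      have := Int.fract_lt_one x
      simp only [id]
      linarith
    · refine tendsto_atBot_mono (fun x => ?_) (tendsto_atBot_add_const_right _ (1 : ℝ) tendsto_id)
      have := (hbound x).2
      have := Int.fract_nonneg x
      simp only [id]
      linarith
  · intro x
    simp only [Int.fract_add_one]
    ring
  · intro x hx
    simp only [Int.fract_eq_self.2 hx]
    ring

lemma IsOPH.continuous {f : S1 → S1} (hf : IsOPH f) : Continuous f := by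
  obtain ⟨F, hmono, hsurj, -, hF⟩ := hf
  have hFc : Continuous F := hmono.monotone.continuous_of_surjective hsurj
  refine QuotientAddGroup.isQuotientMap_mk (AddSubgroup.zmultiples (1 : ℝ)) |>.continuous_iff.2 ?_
  exact ((AddCircle.continuous_mk' (1 : ℝ)).comp hFc).congr fun x => (hF x).symm

/-- If `C` and `D` are increasing homeomorphisms of `ℝ` commuting with integer translations,
then `D⁻¹ ∘ C` descends to the circle, in the coordinates based at `a` and `b`. -/
lemma exists_isOPH_of_lifts (a b : ℝ) {C D : ℝ → ℝ} (hC : StrictMono C)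
    (hCs : Function.Surjective C) (hC1 : ∀ x, C (x + 1) = C x + 1) (hD : StrictMono D)
    (hDs : Function.Surjective D) (hD1 : ∀ x, D (x + 1) = D x + 1) :
    ∃ h : S1 → S1, IsOPH h ∧
      ∀ s t : ℝ, C s = D t → h ((a + s : ℝ) : S1) = ((b + t : ℝ) : S1) := by
  let e := hD.orderIsoOfSurjective D hDs
  have he : ∀ x, e x = D x := fun x => rfl
  have hsymm : ∀ y, e.symm (y + 1) = e.symm y + 1 := by
    intro y
    rw [OrderIso.symm_apply_eq, he, hD1, ← he, e.apply_symm_apply]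
  let F : ℝ → ℝ := fun x => b + e.symm (C (x - a))
  have hF1 : ∀ x, F (x + 1) = F x + 1 := by
    intro x
    simp only [F]
    rw [show x + 1 - a = x - a + 1 by ring, hC1, hsymm, add_assoc]
  have hper : Function.Periodic (fun x => (F x : S1)) 1 := by
    intro x
    simp only [hF1, AddCircle.coe_add_period]
  refine ⟨hper.lift, ⟨F, ?_, ?_, hF1, fun x => rfl⟩, ?_⟩
  · intro x y hxy
    exact add_lt_add_right (e.symm.strictMono (hC (sub_lt_sub_right hxy a))) b
  · intro y
    obtain ⟨x, hx⟩ := hCs (e (y - b))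
    exact ⟨x + a, by simp [F, hx]⟩
  · intro s t hst
    change (F (a + s) : S1) = _
    simp only [F]
    rw [add_sub_cancel_left, hst, ← he, e.symm_apply_apply]

lemma measSupport_map_prodMk_eq_graph {B : Type*} [MeasurableSpace B] {ν : Measure B}
    {φ ψ : B → S1} (hφ : Measurable φ) (hψ : Measurable ψ)
    (hsupp : measSupport (ν.map φ) = univ) {h : S1 → S1} (hh : Continuous h)
    (hae : ∀ᵐ x ∂ν, h (φ x) = ψ x) :
    measSupport (ν.map fun x => (φ x, ψ x)) = {p : S1 × S1 | p.2 = h p.1} := by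
  have hm : Measurable fun x => (φ x, ψ x) := hφ.prodMk hψ
  ext ⟨u, v⟩
  constructor
  · intro hp
    by_contra hne
    have hclosed : IsClosed {p : S1 × S1 | p.2 = h p.1} :=
      isClosed_eq continuous_snd (hh.comp continuous_fst)
    have hpos := hp _ (hclosed.isOpen_compl.mem_nhds hne)
    rw [Measure.map_apply hm hclosed.isOpen_compl.measurableSet] at hpos
    refine hpos.ne' (measure_mono_null ?_ (ae_iff.1 hae))
    intro x hx hx'
    exact hx hx'.symm
  · rintro hv U hU
    obtain ⟨V, hVU, hV, huV⟩ := mem_nhds_iff.1 hU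
    refine lt_of_lt_of_le ?_ (measure_mono hVU)
    rw [Measure.map_apply hm hV.measurableSet]
    have hW : IsOpen ((fun w => (w, h w)) ⁻¹' V) := hV.preimage (continuous_id.prodMk hh)
    have hpos := measure_pos_of_isOpen hsupp hW ⟨u, by
      change v = h u at hv
      subst hv
      exact huV⟩
    rw [Measure.map_apply hφ hW.measurableSet] at hpos
    refine hpos.trans_le (measure_mono_ae ?_)
    filter_upwards [hae] with x hx hx'
    change (φ x, h (φ x)) ∈ V at hx'
    rw [hx] at hx'
    exact hx'

lemma map_arcCoord_law {μ : Measure S1} [IsProbabilityMeasure μ] (hatom : ∀ x, μ {x} = 0)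
    (hsupp : measSupport μ = univ) (a : ℝ) :
    ∃ C : ℝ → ℝ, StrictMono C ∧ Function.Surjective C ∧ (∀ x, C (x + 1) = C x + 1) ∧
      ∀ u, C (arcCoord a u) = ProbabilityTheory.cdf (μ.map (arcCoord a)) (arcCoord a u) := by
  have : IsProbabilityMeasure (μ.map (arcCoord a)) :=
    Measure.isProbabilityMeasure_map (measurable_arcCoord a).aemeasurable
  obtain ⟨C, h1, h2, h3, h4⟩ := exists_periodic_extension_cdf (map_arcCoord_singleton hatom a)
    ((ae_map_iff (measurable_arcCoord a).aemeasurable measurableSet_Ico).2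
      (Eventually.of_forall (arcCoord_mem a)))
    fun s t => map_arcCoord_Ioo_pos hsupp a
  exact ⟨C, h1, h2, h3, fun u => h4 _ (arcCoord_mem a u)⟩

open ProbabilityTheory in
lemma cdf_map_eq_cdf_map_of_lt_iff {B : Type*} [MeasurableSpace B] {ν : Measure B}
    [IsProbabilityMeasure ν] {p q : B → ℝ} (hp : Measurable p) (hq : Measurable q) {s t : ℝ}
    (h : ∀ᵐ x ∂ν, s < p x ↔ t < q x) : cdf (ν.map p) s = cdf (ν.map q) t := by
  have := Measure.isProbabilityMeasure_map (μ := ν) hp.aemeasurable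
  have := Measure.isProbabilityMeasure_map (μ := ν) hq.aemeasurable
  rw [cdf_eq_real, cdf_eq_real, map_measureReal_apply hp measurableSet_Iic,
    map_measureReal_apply hq measurableSet_Iic]
  refine measureReal_congr ?_
  filter_upwards [h] with x hx
  exact propext (by simpa only [not_lt] using! not_congr hx)

lemma ae_arcCoord_pos {B : Type*} [MeasurableSpace B] {ν : Measure B} {φ : B → S1}
    (hφ : Measurable φ) (hatom : ∀ x, ν.map φ {x} = 0) (a : ℝ) :
    ∀ᵐ x ∂ν, 0 < arcCoord a (φ x) := by
  have h := map_arcCoord_singleton hatom a 0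
  rw [Measure.map_map (measurable_arcCoord a) hφ,
    Measure.map_apply ((measurable_arcCoord a).comp hφ) (measurableSet_singleton 0)] at h
  filter_upwards [measure_eq_zero_iff_ae_notMem.1 h] with x hx
  exact (arcCoord_mem a (φ x)).1.lt_of_ne fun h0 => hx h0.symm

/-- If `φ, ψ : B → S¹` are measurable maps on a probability space whose pushforward
measures are atomless with full support and which define the same orientation cocycle
almost everywhere, then there is an orientation preserving homeomorphism `h` of `S¹`
with `h ∘ φ = ψ` almost everywhere, and the support of the distribution of
`x ↦ (φ(x), ψ(x))` is the graph of `h`. -/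
theorem orientation_cocycle_equal_implies_conjugating_homeomorphism
    {B : Type*} [MeasurableSpace B] (ν : Measure B) [IsProbabilityMeasure ν]
    (φ ψ : B → S1) (hφ : Measurable φ) (hψ : Measurable ψ)
    (hφatomless : ∀ x : S1, Measure.map φ ν {x} = 0)
    (hψatomless : ∀ x : S1, Measure.map ψ ν {x} = 0)
    (hφsupp : measSupport (Measure.map φ ν) = Set.univ)
    (hψsupp : measSupport (Measure.map ψ ν) = Set.univ)
    (horient : ∀ᵐ p : B × B × B ∂(ν.prod (ν.prod ν)),
      orient (φ p.1) (φ p.2.1) (φ p.2.2) = orient (ψ p.1) (ψ p.2.1) (ψ p.2.2)) :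
    ∃ h : S1 → S1, IsOPH h ∧ (∀ᵐ x ∂ν, h (φ x) = ψ x) ∧
      measSupport (Measure.map (fun x => (φ x, ψ x)) ν) =
        {p : S1 × S1 | p.2 = h p.1} := by
  have := Measure.isProbabilityMeasure_map (μ := ν) hφ.aemeasurable
  have := Measure.isProbabilityMeasure_map (μ := ν) hψ.aemeasurable
  obtain ⟨x₀, hx₀⟩ := (Measure.ae_ae_of_ae_prod horient).exists
  obtain ⟨a, ha⟩ := QuotientAddGroup.mk_surjective (φ x₀)
  obtain ⟨b, hb⟩ := QuotientAddGroup.mk_surjective (ψ x₀)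
  obtain ⟨C, hC, hCs, hC1, hCcdf⟩ := map_arcCoord_law hφatomless hφsupp a
  obtain ⟨D, hD, hDs, hD1, hDcdf⟩ := map_arcCoord_law hψatomless hψsupp b
  obtain ⟨h, hoph, hh⟩ := exists_isOPH_of_lifts a b hC hCs hC1 hD hDs hD1
  have hae : ∀ᵐ x ∂ν, h (φ x) = ψ x := by
    filter_upwards [Measure.ae_ae_of_ae_prod hx₀, ae_arcCoord_pos hφ hφatomless a,
      ae_arcCoord_pos hψ hψatomless b] with y hy hpy hqy
    rw [← coe_add_arcCoord a (φ y), ← coe_add_arcCoord b (ψ y)]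
    refine hh _ _ ?_
    rw [hCcdf, hDcdf, Measure.map_map (measurable_arcCoord a) hφ,
      Measure.map_map (measurable_arcCoord b) hψ]
    refine cdf_map_eq_cdf_map_of_lt_iff ((measurable_arcCoord a).comp hφ)
      ((measurable_arcCoord b).comp hψ) ?_
    filter_upwards [hy] with z hz
    have hiff : PosOriented (φ x₀) (φ y) (φ z) ↔ PosOriented (ψ x₀) (ψ y) (ψ z) := by
      rw [← orient_eq_one_iff, ← orient_eq_one_iff]
      exact hz ▸ Iff.rfl
    rw [← ha, ← hb] at hiff
    exact (and_iff_right hpy).symm.trans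
      (((posOriented_coe_iff a _ _).symm.trans (hiff.trans (posOriented_coe_iff b _ _))).trans
        (and_iff_right hqy))
  exact ⟨h, hoph, hae, measSupport_map_prodMk_eq_graph hφ hψ hφsupp hoph.continuous hae⟩

end
end

section
/- Let g ∈ Homeo⁺(S¹) be an orientation-preserving homeomorphism normalizing the rotation group Rot, i.e. g∘r∘g⁻¹ ∈ Rot for every r ∈ Rot. Then g ∈ Rot. Consequently, the normalizer of Rot in Homeo⁺(S¹) and the centralizer of Rot in Homeo⁺(S¹) both equal Rot. -/
open Filter MeasureTheory Set
open scoped Classical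

noncomputable section

/-- A degree-one lift of a map normalizing the rotations is additive up to a constant. -/
theorem IsCircleLift.add_of_normalizes {g : S1 → S1} {F : ℝ → ℝ} (hF : IsCircleLift g F)
    (hnorm : ∀ a : S1, ∃ b : S1, g ∘ (fun x => x + a) = (fun x => x + b) ∘ g) (x a : ℝ) :
    F (x + a) = F x + (F a - F 0) := by
  obtain ⟨hmono, -, hone, hlift⟩ := hF
  let f : CircleDeg1Lift := ⟨⟨F, hmono.monotone⟩, hone⟩
  have hint : ∀ y (n : ℤ), F (y + n) = F y + n := f.map_add_int
  -- It suffices to treat translations by `a ∈ [0, 1)`: then both increments lie in `[0, 1)`.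
  have key : ∀ a : ℝ, 0 ≤ a → a < 1 → F (x + a) - F x = F a - F 0 := by
    intro a ha₀ ha₁
    obtain ⟨b, hb⟩ := hnorm a
    have hinc : ∀ y : ℝ, ((F (y + a) - F y : ℝ) : S1) = b := by
      intro y
      have h := congrFun hb (y : S1)
      simp only [Function.comp_apply] at h
      rw [← AddCircle.coe_add, hlift, hlift] at h
      rw [AddCircle.coe_sub, h, add_sub_cancel_left]
    have hbound : ∀ y, F (y + a) - F y ∈ Ico (0 : ℝ) (0 + 1) := by
      intro y
      have h₀ := hmono.monotone (le_add_of_nonneg_right ha₀ : y ≤ y + a)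
      have h₁ := hmono (by linarith : y + a < y + 1)
      rw [hone] at h₁
      constructor <;> linarith
    have hzero := hinc 0
    have hbound_zero := hbound 0
    rw [zero_add a] at hzero hbound_zero
    exact (AddCircle.coe_eq_coe_iff_of_mem_Ico (hbound x) hbound_zero).1
      ((hinc x).trans hzero.symm)
  have hfract := key (Int.fract a) (Int.fract_nonneg a) (Int.fract_lt_one a)
  have hx := hint (x + Int.fract a) ⌊a⌋
  have ha := hint (Int.fract a) ⌊a⌋
  rw [add_assoc, Int.fract_add_floor] at hx
  rw [Int.fract_add_floor] at ha
  linarith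

/-- An orientation preserving homeomorphism normalizing the rotations is a rotation. -/
theorem IsOPH.exists_eq_add_of_normalizes {g : S1 → S1} (hg : IsOPH g)
    (hnorm : ∀ a : S1, ∃ b : S1, g ∘ (fun x => x + a) = (fun x => x + b) ∘ g) :
    ∃ a : S1, g = fun x => x + a := by
  obtain ⟨F, hF⟩ := hg
  have hadd := hF.add_of_normalizes hnorm
  obtain ⟨hmono, hsurj, hone, hlift⟩ := hF
  let G : ℝ →+ ℝ := AddMonoidHom.mk' (fun x => F x - F 0) fun x y => by
    rw [hadd x y]; ring
  have hG : Continuous G :=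
    (hmono.monotone.continuous_of_surjective hsurj).sub continuous_const
  have hG_one : G 1 = 1 := by
    have h := hone 0
    rw [zero_add] at h
    change F 1 - F 0 = 1
    linarith
  have hFx : ∀ x, F x = x + F 0 := by
    intro x
    have h : G (x • 1) = x • G 1 := map_real_smul G hG x 1
    rw [hG_one, smul_eq_mul, mul_one] at h
    exact sub_eq_iff_eq_add.1 h
  refine ⟨(F 0 : S1), funext fun x => ?_⟩
  induction x using QuotientAddGroup.induction_on with
  | H x => exact (hlift x).trans (by rw [hFx x, AddCircle.coe_add])

/-- Rotations are orientation preserving homeomorphisms. -/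
theorem isOPH_add_right (a : S1) : IsOPH fun x => x + a := by
  induction a using QuotientAddGroup.induction_on with
  | H r =>
    exact ⟨fun x => x + r, fun _ _ h => add_lt_add_left h r,
      fun y => ⟨y - r, sub_add_cancel y r⟩, fun x => add_right_comm x 1 r, fun _ => rfl⟩

/-- Rotations commute. -/
theorem add_right_comp_comm (a c : S1) :
    (fun x : S1 => x + c) ∘ (fun x => x + a) = (fun x => x + a) ∘ fun x => x + c :=
  funext fun x => add_right_comm x a c

/-- An orientation preserving homeomorphism of the circle normalizing the rotation
group is itself a rotation; consequently both the normalizer and the centralizer of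
`Rot` in `Homeo⁺(S¹)` equal `Rot`. -/
theorem normalizer_of_rotations_eq_rotations
    (g : S1 → S1) (hg : IsOPH g)
    (hnorm : ∀ a : S1, ∃ b : S1, g ∘ (fun x => x + a) = (fun x => x + b) ∘ g) :
    (∃ a : S1, g = fun x => x + a) ∧
    ({g' : S1 → S1 | IsOPH g' ∧
        ∀ a : S1, ∃ b : S1, g' ∘ (fun x => x + a) = (fun x => x + b) ∘ g'} =
      {g' : S1 → S1 | ∃ a : S1, g' = fun x => x + a}) ∧
    ({g' : S1 → S1 | IsOPH g' ∧
        ∀ a : S1, g' ∘ (fun x => x + a) = (fun x => x + a) ∘ g'} =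
      {g' : S1 → S1 | ∃ a : S1, g' = fun x => x + a}) := by
  refine ⟨hg.exists_eq_add_of_normalizes hnorm, ?_, ?_⟩
  · refine Subset.antisymm (fun g' h => h.1.exists_eq_add_of_normalizes h.2) ?_
    rintro _ ⟨c, rfl⟩
    exact ⟨isOPH_add_right c, fun a => ⟨a, add_right_comp_comm a c⟩⟩
  · refine Subset.antisymm
      (fun g' h => h.1.exists_eq_add_of_normalizes fun a => ⟨a, h.2 a⟩) ?_
    rintro _ ⟨c, rfl⟩
    exact ⟨isOPH_add_right c, fun a => add_right_comp_comm a c⟩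

end
end

section
/- Let G be a countable group acting on a standard Borel probability space (B,ν) by measurable transformations preserving the measure class of ν, such that the diagonal G-action on (B×B, ν⊗ν) is ergodic: every measurable A ⊆ B×B with g·A = A up to null sets for all g ∈ G satisfies (ν⊗ν)(A) ∈ {0,1}. Let ω : B³ → ℝ be a measurable map which is a strict alternating cocycle (ω(x_{σ(1)},x_{σ(2)},x_{σ(3)}) = sign(σ)·ω(x₁,x₂,x₃) for all permutations σ, and ω(y,z,w) − ω(x,z,w) + ω(x,y,w) − ω(x,y,z) = 0 for all x,y,z,w ∈ B), which is G-invariant (for every g ∈ G, ω(g·x,g·y,g·z) = ω(x,y,z) for ν³-almost every (x,y,z)), and which satisfies ω(x,y,z) ∈ {−1,1} for ν³-almost every (x,y,z). Then there exists a measurable map φ : B → S¹ such that: (a) the pushforward φ_*ν is atomless; (b) the support of φ_*ν is all of S¹; (c) o(φ(x),φ(y),φ(z)) = ω(x,y,z) for ν³-almost every (x,y,z) ∈ B³. -/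
open Filter MeasureTheory Set
open scoped Classical

noncomputable section

/-- The value `1` if `a < b` and `-1` otherwise. -/
def compareSign (a b : ℝ) : ℝ := if a < b then 1 else -1

lemma exists_int_add_of_coe_eq {u v : ℝ} (h : (u : S1) = (v : S1)) : ∃ n : ℤ, u = v + n := by
  rw [← sub_eq_zero, ← AddCircle.coe_sub, AddCircle.coe_eq_zero_iff] at h
  obtain ⟨n, hn⟩ := h
  exact ⟨n, by simp only [zsmul_eq_mul, mul_one] at hn; linarith⟩

lemma posOriented_coe_iff_s19 {a b c : ℝ} (ha : a ∈ Ioo (0 : ℝ) 1) (hb : b ∈ Ioo (0 : ℝ) 1)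
    (hc : c ∈ Ioo (0 : ℝ) 1) :
    PosOriented (a : S1) (b : S1) (c : S1) ↔
      (a < b ∧ b < c) ∨ (b < c ∧ c < a) ∨ (c < a ∧ a < b) := by
  obtain ⟨ha0, ha1⟩ := ha
  obtain ⟨hb0, hb1⟩ := hb
  obtain ⟨hc0, hc1⟩ := hc
  constructor
  · rintro ⟨a', b', c', hxa, hxb, hxc, h1, h2, h3⟩
    obtain ⟨i, rfl⟩ := exists_int_add_of_coe_eq hxa
    obtain ⟨j, rfl⟩ := exists_int_add_of_coe_eq hxb
    obtain ⟨k, rfl⟩ := exists_int_add_of_coe_eq hxc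
    have hij : i ≤ j := by
      have : (i : ℝ) < j + 1 := by linarith
      exact Int.lt_add_one_iff.mp (by exact_mod_cast this)
    have hjk : j ≤ k := by
      have : (j : ℝ) < k + 1 := by linarith
      exact Int.lt_add_one_iff.mp (by exact_mod_cast this)
    have hki : k ≤ i + 1 := by
      have : (k : ℝ) < i + 1 + 1 := by linarith
      exact Int.lt_add_one_iff.mp (by exact_mod_cast this)
    obtain ⟨rfl, rfl⟩ | ⟨rfl, rfl⟩ | ⟨rfl, rfl⟩ :
        (j = i ∧ k = i) ∨ (j = i ∧ k = i + 1) ∨ (j = i + 1 ∧ k = i + 1) := by omega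
    · exact Or.inl ⟨by linarith, by linarith⟩
    · push_cast at *
      exact Or.inr (Or.inr ⟨by linarith, by linarith⟩)
    · push_cast at *
      exact Or.inr (Or.inl ⟨by linarith, by linarith⟩)
  · have hp : ∀ u : ℝ, ((u + 1 : ℝ) : S1) = (u : S1) := fun u => AddCircle.coe_add_period 1 u
    rintro (⟨h1, h2⟩ | ⟨h1, h2⟩ | ⟨h1, h2⟩)
    · exact ⟨a, b, c, rfl, rfl, rfl, h1, h2, by linarith⟩
    · exact ⟨a, b + 1, c + 1, rfl, hp b, hp c, by linarith, by linarith, by linarith⟩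
    · exact ⟨a, b, c + 1, rfl, rfl, hp c, by linarith, by linarith, by linarith⟩

lemma orient_coe {a b c : ℝ} (ha : a ∈ Ioo (0 : ℝ) 1) (hb : b ∈ Ioo (0 : ℝ) 1)
    (hc : c ∈ Ioo (0 : ℝ) 1) (hab : a ≠ b) (hbc : b ≠ c) (hac : a ≠ c) :
    orient (a : S1) (b : S1) (c : S1) = compareSign b c - compareSign a c + compareSign a b := by
  unfold orient compareSign
  rw [if_congr (posOriented_coe_iff_s19 ha hb hc) rfl rfl,
    if_congr (posOriented_coe_iff_s19 hc hb ha) rfl rfl]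
  rcases lt_or_gt_of_ne hab with h1 | h1 <;> rcases lt_or_gt_of_ne hbc with h2 | h2 <;>
    rcases lt_or_gt_of_ne hac with h3 | h3 <;>
    simp only [h1, h2, h3, h1.not_gt, h2.not_gt, h3.not_gt, and_true, and_false, or_true,
      or_false, and_self, or_self, if_true, if_false] <;> norm_num <;> linarith

/-- If an atomless probability measure on `ℝ` is such that its distribution function is almost
everywhere the identity, then its distribution function is the identity on `(0,1)`. -/
lemma cdf_eq_self_of_ae_eq (μ : Measure ℝ) [IsProbabilityMeasure μ] [NullSingletonClass μ]
    (h : ∀ᵐ t ∂μ, ProbabilityTheory.cdf μ t = t) {c : ℝ} (hc : c ∈ Ioo (0 : ℝ) 1) :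
    ProbabilityTheory.cdf μ c = c := by
  set F := ProbabilityTheory.cdf μ with hF
  have hcont : Continuous F := by
    rw [continuous_iff_continuousAt]
    intro x
    rw [F.mono.continuousAt_iff_leftLim_eq_rightLim, F.rightLim_eq]
    have h1 : F.measure {x} = 0 := by
      rw [hF, ProbabilityTheory.measure_cdf]
      exact measure_singleton x
    rw [F.measure_singleton, ENNReal.ofReal_eq_zero] at h1
    exact le_antisymm (F.mono.leftLim_le le_rfl) (by linarith)
  obtain ⟨t, ht⟩ : c ∈ range F := by
    apply mem_range_of_exists_le_of_exists_ge hcont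
    · exact (((ProbabilityTheory.tendsto_cdf_atBot μ).eventually_lt_const hc.1).exists).imp
        fun _ => le_of_lt
    · exact (((ProbabilityTheory.tendsto_cdf_atTop μ).eventually_const_lt hc.2).exists).imp
        fun _ => le_of_lt
  have hle : μ.real {x | F x < c} ≤ c := by
    conv_rhs => rw [← ht, hF, ProbabilityTheory.cdf_eq_real]
    refine measureReal_mono fun x hx => ?_
    by_contra hxt
    have := F.mono (not_le.mp hxt).le
    simp only [mem_ofPred_eq] at hx
    linarith
  have hge : c ≤ μ.real {x | F x ≤ c} := by
    conv_lhs => rw [← ht, hF, ProbabilityTheory.cdf_eq_real]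
    refine measureReal_mono fun x hx => ?_
    have := F.mono hx
    simp only [mem_ofPred_eq]
    linarith
  have e1 : μ.real {x | F x < c} = F c := by
    rw [hF, ProbabilityTheory.cdf_eq_real, ← measureReal_congr (Iio_ae_eq_Iic (μ := μ) (a := c))]
    refine measureReal_congr ?_
    filter_upwards [h] with x hx
    exact propext (by change F x < c ↔ x < c; rw [hx])
  have e2 : μ.real {x | F x ≤ c} = F c := by
    rw [hF, ProbabilityTheory.cdf_eq_real]
    refine measureReal_congr ?_
    filter_upwards [h] with x hx
    exact propext (by change F x ≤ c ↔ x ≤ c; rw [hx])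
  linarith

section Triples

variable {B : Type*} [MeasurableSpace B] {ν : Measure B} [IsProbabilityMeasure ν]

lemma ae_triple_rotate {P : B → B → B → Prop}
    (h : ∀ᵐ p ∂ν.prod (ν.prod ν), P p.1 p.2.1 p.2.2) :
    ∀ᵐ p ∂ν.prod (ν.prod ν), P p.2.1 p.2.2 p.1 :=
  ((measurePreserving_prodAssoc ν ν ν).comp
    (Measure.measurePreserving_swap (μ := ν) (ν := ν.prod ν))).quasiMeasurePreserving.ae h

lemma ae_triple_swap {P : B → B → B → Prop}
    (h : ∀ᵐ p ∂ν.prod (ν.prod ν), P p.1 p.2.1 p.2.2) :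
    ∀ᵐ p ∂ν.prod (ν.prod ν), P p.1 p.2.2 p.2.1 :=
  ((MeasurePreserving.id ν).prod
    (Measure.measurePreserving_swap (μ := ν) (ν := ν))).quasiMeasurePreserving.ae h

lemma ae_triple_of_ae_pair {P : B → B → Prop} (h : ∀ᵐ p ∂ν.prod ν, P p.1 p.2) :
    ∀ᵐ p ∂ν.prod (ν.prod ν), P p.1 p.2.1 ∧ P p.2.1 p.2.2 ∧ P p.1 p.2.2 := by
  have h23 : ∀ᵐ p ∂ν.prod (ν.prod ν), P p.2.1 p.2.2 :=
    Measure.quasiMeasurePreserving_snd.ae h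
  have h31 := ae_triple_rotate (P := fun _ y z => P y z) h23
  have h12 := ae_triple_rotate (P := fun x _ z => P z x) h31
  have h13 := ae_triple_swap (P := fun x y _ => P x y) h12
  filter_upwards [h12, h23, h13] with p h1 h2 h3 using ⟨h1, h2, h3⟩

end Triples

section Rank

variable {B : Type*} [MeasurableSpace B] (ν : Measure B) [IsProbabilityMeasure ν] (s : B → B → ℝ)

/-- The measure of the set of predecessors of a point for the relation `s u y = 1`. -/
def predecessorMass (y : B) : ℝ := ν.real {u | s u y = 1}

variable {ν s}

lemma measurable_predecessorMass (hs : Measurable fun p : B × B => s p.1 p.2) :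
    Measurable (predecessorMass ν s) :=
  (measurable_measure_prodMk_right (μ := ν) (hs (measurableSet_singleton 1))).ennreal_toReal

lemma ae_ae_of_ae_triple {P : B → B → B → Prop}
    (h : ∀ᵐ p ∂ν.prod (ν.prod ν), P p.1 p.2.1 p.2.2) :
    ∀ᵐ q ∂ν.prod ν, ∀ᵐ u ∂ν, P u q.1 q.2 :=
  Measure.ae_ae_of_ae_prod
    ((Measure.measurePreserving_swap (μ := ν.prod ν) (ν := ν)).quasiMeasurePreserving.ae h)

/-- For an almost everywhere defined measurable linear order, almost every triple of points
contains two points with different masses of predecessors. -/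
lemma ae_not_predecessorMass_eq (hs : Measurable fun p : B × B => s p.1 p.2)
    (hanti : ∀ y z, s z y = -s y z)
    (hpm : ∀ᵐ p ∂ν.prod ν, s p.1 p.2 = 1 ∨ s p.1 p.2 = -1)
    (htr : ∀ᵐ p ∂ν.prod (ν.prod ν), s p.1 p.2.1 = 1 → s p.2.1 p.2.2 = 1 → s p.1 p.2.2 = 1) :
    ∀ᵐ p ∂ν.prod (ν.prod ν), ¬ (predecessorMass ν s p.1 = predecessorMass ν s p.2.1 ∧
      predecessorMass ν s p.2.1 = predecessorMass ν s p.2.2) := by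
  set f := predecessorMass ν s with hf
  have hfm : Measurable f := measurable_predecessorMass hs
  have hs' : ∀ y, MeasurableSet {u | s u y = 1} := fun y =>
    (hs.comp measurable_prodMk_right) (measurableSet_singleton 1)
  have hbetween : ∀ᵐ p ∂ν.prod (ν.prod ν),
      ¬ (s p.2.1 p.1 = 1 ∧ s p.1 p.2.2 = 1 ∧ s p.2.1 p.2.2 = 1 ∧ f p.2.1 = f p.2.2) := by
    have hm : MeasurableSet {q : (B × B) × B |
        ¬ (s q.1.1 q.2 = 1 ∧ s q.2 q.1.2 = 1 ∧ s q.1.1 q.1.2 = 1 ∧ f q.1.1 = f q.1.2)} := by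
      refine MeasurableSet.compl ?_
      refine (measurableSet_eq_fun (hs.comp (by fun_prop : Measurable fun q : (B × B) × B =>
        (q.1.1, q.2))) measurable_const).inter ?_
      refine (measurableSet_eq_fun (hs.comp (by fun_prop : Measurable fun q : (B × B) × B =>
        (q.2, q.1.2))) measurable_const).inter ?_
      refine (measurableSet_eq_fun (hs.comp (by fun_prop : Measurable fun q : (B × B) × B =>
        q.1)) measurable_const).inter ?_
      exact measurableSet_eq_fun (by fun_prop) (by fun_prop)
    have key : ∀ᵐ q ∂(ν.prod ν).prod ν,
        ¬ (s q.1.1 q.2 = 1 ∧ s q.2 q.1.2 = 1 ∧ s q.1.1 q.1.2 = 1 ∧ f q.1.1 = f q.1.2) := by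
      refine (Measure.ae_prod_iff_ae_ae hm).2 ?_
      filter_upwards [ae_ae_of_ae_triple
        (P := fun u y z => s u y = 1 → s y z = 1 → s u z = 1) htr] with q hq
      by_cases h : s q.1 q.2 = 1 ∧ f q.1 = f q.2
      · have hsub : {u | s u q.1 = 1} ≤ᵐ[ν] {u | s u q.2 = 1} := by
          filter_upwards [hq] with u hu h1 using hu h1 h.1
        have heq : {u | s u q.1 = 1} =ᵐ[ν] {u | s u q.2 = 1} := by
          refine ae_eq_of_ae_subset_of_measure_ge hsub ?_ (hs' _).nullMeasurableSet
            (measure_ne_top _ _)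
          exact ((ENNReal.toReal_eq_toReal_iff' (measure_ne_top _ _) (measure_ne_top _ _)).1
            h.2).ge
        filter_upwards [heq] with u hu hcontra
        have h1 : s u q.1 = 1 := (iff_of_eq hu).2 hcontra.2.1
        have h2 := hanti u q.1
        rw [hcontra.1, h1] at h2
        norm_num at h2
      · exact ae_of_all _ fun u hu => h hu.2.2
    exact (Measure.measurePreserving_swap (μ := ν) (ν := ν.prod ν)).quasiMeasurePreserving.ae key
  have b213 := hbetween
  have b231 := ae_triple_swap (P := fun u y z =>
    ¬ (s y u = 1 ∧ s u z = 1 ∧ s y z = 1 ∧ f y = f z)) hbetween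
  have r1 := ae_triple_rotate (P := fun u y z =>
    ¬ (s y u = 1 ∧ s u z = 1 ∧ s y z = 1 ∧ f y = f z)) b213
  have r2 := ae_triple_rotate (P := fun x u y =>
    ¬ (s y u = 1 ∧ s u x = 1 ∧ s y x = 1 ∧ f y = f x)) r1
  have r3 := ae_triple_rotate (P := fun u z y =>
    ¬ (s y u = 1 ∧ s u z = 1 ∧ s y z = 1 ∧ f y = f z)) b231
  have r4 := ae_triple_rotate (P := fun x u y =>
    ¬ (s x u = 1 ∧ s u y = 1 ∧ s x y = 1 ∧ f x = f y)) r3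
  have htr' := ae_triple_rotate (P := fun x y z => s y x = 1 → s x z = 1 → s y z = 1)
    (ae_triple_rotate (P := fun x y z => s x z = 1 → s z y = 1 → s x y = 1)
      (ae_triple_swap (P := fun x y z => s x y = 1 → s y z = 1 → s x z = 1) htr))
  filter_upwards [b213, b231, r1, r2, r3, r4, htr, htr',
    ae_triple_of_ae_pair (P := fun y z => s y z = 1 ∨ s y z = -1) hpm]
    with p h1 h2 h3 h4 h5 h6 ht ht' hp
  have e1 := hanti p.1 p.2.1
  have e2 := hanti p.2.1 p.2.2
  have e3 := hanti p.1 p.2.2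
  rintro ⟨q1, q2⟩
  obtain ⟨p1, p2, p3⟩ := hp
  grind

lemma measure_predecessorMass_eq (hs : Measurable fun p : B × B => s p.1 p.2)
    (hanti : ∀ y z, s z y = -s y z)
    (hpm : ∀ᵐ p ∂ν.prod ν, s p.1 p.2 = 1 ∨ s p.1 p.2 = -1)
    (htr : ∀ᵐ p ∂ν.prod (ν.prod ν), s p.1 p.2.1 = 1 → s p.2.1 p.2.2 = 1 → s p.1 p.2.2 = 1)
    (c : ℝ) : ν {y | predecessorMass ν s y = c} = 0 := by
  set A := {y | predecessorMass ν s y = c}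
  have h : (ν.prod (ν.prod ν)) (A ×ˢ (A ×ˢ A)) = 0 := by
    refine measure_mono_null ?_ (ae_iff.1 (ae_not_predecessorMass_eq hs hanti hpm htr))
    rintro ⟨x, y, z⟩ ⟨hx, hy, hz⟩
    simp only [A, mem_ofPred_eq] at hx hy hz
    simp [hx, hy, hz]
  simpa [Measure.prod_prod] using h

/-- An almost everywhere defined measurable linear order is almost everywhere the order between
the masses of predecessors. -/
lemma ae_eq_compareSign (hs : Measurable fun p : B × B => s p.1 p.2)
    (hanti : ∀ y z, s z y = -s y z)
    (hpm : ∀ᵐ p ∂ν.prod ν, s p.1 p.2 = 1 ∨ s p.1 p.2 = -1)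
    (htr : ∀ᵐ p ∂ν.prod (ν.prod ν), s p.1 p.2.1 = 1 → s p.2.1 p.2.2 = 1 → s p.1 p.2.2 = 1) :
    ∀ᵐ p ∂ν.prod ν, s p.1 p.2 = compareSign (predecessorMass ν s p.1) (predecessorMass ν s p.2) ∧
      predecessorMass ν s p.1 ≠ predecessorMass ν s p.2 := by
  have hfm : Measurable (predecessorMass ν s) := measurable_predecessorMass hs
  have hne : ∀ᵐ p ∂ν.prod ν, predecessorMass ν s p.1 ≠ predecessorMass ν s p.2 := by
    refine (Measure.ae_prod_iff_ae_ae
      (measurableSet_eq_fun (by fun_prop) (by fun_prop)).compl).2 (ae_of_all _ fun y => ?_)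
    simpa [ae_iff, eq_comm] using
      measure_predecessorMass_eq hs hanti hpm htr (predecessorMass ν s y)
  have hmono : ∀ᵐ p ∂ν.prod ν, s p.1 p.2 = 1 →
      predecessorMass ν s p.1 ≤ predecessorMass ν s p.2 := by
    filter_upwards [ae_ae_of_ae_triple
      (P := fun u y z => s u y = 1 → s y z = 1 → s u z = 1) htr] with q hq h
    refine ENNReal.toReal_mono (measure_ne_top _ _) (measure_mono_ae ?_)
    filter_upwards [hq] with u hu h1 using hu h1 h
  have hmono' : ∀ᵐ p ∂ν.prod ν, s p.2 p.1 = 1 →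
      predecessorMass ν s p.2 ≤ predecessorMass ν s p.1 :=
    (Measure.measurePreserving_swap (μ := ν) (ν := ν)).quasiMeasurePreserving.ae hmono
  filter_upwards [hne, hmono, hmono', hpm] with p h1 h2 h3 h4
  refine ⟨?_, h1⟩
  rcases h4 with h4 | h4
  · rw [compareSign, if_pos (lt_of_le_of_ne (h2 h4) h1), h4]
  · rw [compareSign, if_neg (not_lt.2 (h3 (by rw [hanti, h4]; norm_num))), h4]

/-- The distribution function of the mass of predecessors is almost everywhere the identity. -/
lemma cdf_map_predecessorMass (hs : Measurable fun p : B × B => s p.1 p.2)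
    (hanti : ∀ y z, s z y = -s y z)
    (hpm : ∀ᵐ p ∂ν.prod ν, s p.1 p.2 = 1 ∨ s p.1 p.2 = -1)
    (htr : ∀ᵐ p ∂ν.prod (ν.prod ν), s p.1 p.2.1 = 1 → s p.2.1 p.2.2 = 1 → s p.1 p.2.2 = 1) :
    ∀ᵐ t ∂ν.map (predecessorMass ν s),
      ProbabilityTheory.cdf (ν.map (predecessorMass ν s)) t = t := by
  have hfm : Measurable (predecessorMass ν s) := measurable_predecessorMass hs
  have : IsProbabilityMeasure (ν.map (predecessorMass ν s)) :=
    Measure.isProbabilityMeasure_map hfm.aemeasurable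
  rw [ae_map_iff hfm.aemeasurable (measurableSet_eq_fun
    (ProbabilityTheory.cdf _).mono.measurable measurable_id')]
  have h : ∀ᵐ p ∂ν.prod ν, s p.2 p.1 =
      compareSign (predecessorMass ν s p.2) (predecessorMass ν s p.1) ∧
      predecessorMass ν s p.2 ≠ predecessorMass ν s p.1 :=
    (Measure.measurePreserving_swap (μ := ν) (ν := ν)).quasiMeasurePreserving.ae
      (ae_eq_compareSign hs hanti hpm htr)
  filter_upwards [Measure.ae_ae_of_ae_prod h] with y hy
  rw [ProbabilityTheory.cdf_eq_real, map_measureReal_apply hfm measurableSet_Iic]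
  refine measureReal_congr ?_
  filter_upwards [hy] with u hu
  refine propext ?_
  change predecessorMass ν s u ≤ predecessorMass ν s y ↔ s u y = 1
  rw [hu.1, compareSign, le_iff_lt_or_eq, or_iff_left hu.2]
  split_ifs with hlt <;> simp [hlt]
  norm_num

end Rank

/-- A probability measure on `ℝ` whose distribution function is the identity on `(0,1)` has an
image on the circle with full support. -/
lemma measSupport_map_coe_eq_univ (μ : Measure ℝ) [IsProbabilityMeasure μ]
    (h : ∀ c ∈ Ioo (0 : ℝ) 1, ProbabilityTheory.cdf μ c = c) :
    measSupport (μ.map fun t : ℝ => (t : S1)) = univ := by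
  have hm : Measurable fun t : ℝ => (t : S1) := AddCircle.measurable_mk'
  refine eq_univ_of_forall fun x U hU => ?_
  obtain ⟨V, hVU, hVo, hxV⟩ := mem_nhds_iff.1 hU
  refine lt_of_lt_of_le ?_ (measure_mono hVU)
  rw [Measure.map_apply hm hVo.measurableSet]
  obtain ⟨r, hr, rfl⟩ : ∃ r ∈ Ico (0 : ℝ) 1, (r : S1) = x := by
    obtain ⟨⟨r, hr⟩, hrx⟩ := (AddCircle.equivIco (1 : ℝ) 0).symm.surjective x
    exact ⟨r, by simpa using hr, hrx⟩
  have hW : (fun t : ℝ => (t : S1)) ⁻¹' V ∈ nhds r :=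
    (hVo.preimage (AddCircle.continuous_mk' 1)).mem_nhds hxV
  obtain ⟨ε, hε, hball⟩ := Metric.mem_nhds_iff.1 hW
  set m := min (r + ε) 1 with hm
  have hm1 : m ≤ 1 := min_le_right _ _
  have hm2 : m ≤ r + ε := min_le_left _ _
  have hrm : r < m := lt_min (by linarith) hr.2
  have hr0 := hr.1
  have hsub : Ioc (r + (m - r) / 3) (r + (m - r) / 2) ⊆ (fun t : ℝ => (t : S1)) ⁻¹' V := by
    refine fun t ht => hball ?_
    rw [Metric.mem_ball, Real.dist_eq, abs_lt]
    constructor <;> linarith [ht.1, ht.2]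
  refine lt_of_lt_of_le ?_ (measure_mono hsub)
  rw [← ProbabilityTheory.measure_cdf μ, StieltjesFunction.measure_Ioc,
    ENNReal.ofReal_pos, h _ ⟨by linarith, by linarith⟩, h _ ⟨by linarith, by linarith⟩]
  linarith

/-- **Step 1 of the construction.**  Let a countable group `G` act on a standard
Borel probability space `(B,ν)` preserving the measure class, with the diagonal
action on `B × B` ergodic.  Every measurable `G`-invariant strict alternating cocycle
`ω : B³ → ℝ` with values in `{±1}` almost everywhere is the pullback of the
orientation cocycle of the circle under a measurable map `φ : B → S¹` whose
distribution is atomless and has full support. -/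
theorem invariant_pm_one_cocycle_comes_from_circle_map
    {G B : Type*} [Group G] [Countable G] [MeasurableSpace B] [StandardBorelSpace B]
    [MulAction G B] (ν : Measure B) [IsProbabilityMeasure ν]
    (hmeas : ∀ g : G, Measurable fun x : B => g • x)
    (hqm : ∀ (g : G) (E : Set B), ν E = 0 ↔ ν ((fun x : B => g • x) '' E) = 0)
    (herg : ∀ A : Set (B × B), MeasurableSet A →
      (∀ g : G, (ν.prod ν) (symmDiff A ((fun p : B × B => (g • p.1, g • p.2)) ⁻¹' A)) = 0) →
      (ν.prod ν) A = 0 ∨ (ν.prod ν) A = 1)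
    (ω : B → B → B → ℝ)
    (hωmeas : Measurable fun p : B × B × B => ω p.1 p.2.1 p.2.2)
    (halt : ∀ (σ : Equiv.Perm (Fin 3)) (v : Fin 3 → B),
      ω (v (σ 0)) (v (σ 1)) (v (σ 2)) =
        ((Equiv.Perm.sign σ : ℤ) : ℝ) * ω (v 0) (v 1) (v 2))
    (hcoc : ∀ x y z w : B, ω y z w - ω x z w + ω x y w - ω x y z = 0)
    (hinv : ∀ g : G, ∀ᵐ p : B × B × B ∂(ν.prod (ν.prod ν)),
      ω (g • p.1) (g • p.2.1) (g • p.2.2) = ω p.1 p.2.1 p.2.2)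
    (hpm : ∀ᵐ p : B × B × B ∂(ν.prod (ν.prod ν)),
      ω p.1 p.2.1 p.2.2 = 1 ∨ ω p.1 p.2.1 p.2.2 = -1) :
    ∃ φ : B → S1, Measurable φ ∧
      (∀ x : S1, Measure.map φ ν {x} = 0) ∧
      measSupport (Measure.map φ ν) = Set.univ ∧
      (∀ᵐ p : B × B × B ∂(ν.prod (ν.prod ν)),
        orient (φ p.1) (φ p.2.1) (φ p.2.2) = ω p.1 p.2.1 p.2.2) := by
  have hswap : ∀ x y z, ω x z y = -ω x y z := by
    intro x y z
    have := halt (Equiv.swap 1 2) ![x, y, z]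
    rw [Equiv.Perm.sign_swap (by decide)] at this
    simpa [Equiv.swap_apply_of_ne_of_ne] using this
  obtain ⟨x₀, hx₀⟩ := (Measure.ae_ae_of_ae_prod hpm).exists
  set s : B → B → ℝ := ω x₀ with hs_def
  have hs : Measurable fun p : B × B => s p.1 p.2 := hωmeas.comp measurable_prodMk_left
  have hanti : ∀ y z, s z y = -s y z := hswap x₀
  have hco : ∀ x y z, ω x y z = s y z - s x z + s x y := fun x y z => by
    linarith [hcoc x₀ x y z]
  have htr : ∀ᵐ p ∂ν.prod (ν.prod ν),
      s p.1 p.2.1 = 1 → s p.2.1 p.2.2 = 1 → s p.1 p.2.2 = 1 := by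
    filter_upwards [hpm, ae_triple_of_ae_pair (P := fun y z => s y z = 1 ∨ s y z = -1) hx₀]
      with p hp ht h12 h23
    refine ht.2.2.resolve_right fun h13 => ?_
    rw [hco, h12, h23, h13] at hp
    norm_num at hp
  set f := predecessorMass ν s with hf
  have hfm : Measurable f := measurable_predecessorMass hs
  have hatom := measure_predecessorMass_eq hs hanti hx₀ htr
  have hprob : IsProbabilityMeasure (ν.map f) := Measure.isProbabilityMeasure_map hfm.aemeasurable
  have hnull : NullSingletonClass (ν.map f) :=
    ⟨fun c => by rw [Measure.map_apply hfm (measurableSet_singleton c)]; exact hatom c⟩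
  have hcdf : ∀ c ∈ Ioo (0 : ℝ) 1, ProbabilityTheory.cdf (ν.map f) c = c := fun c hc =>
    cdf_eq_self_of_ae_eq _ (cdf_map_predecessorMass hs hanti hx₀ htr) hc
  have hmk : Measurable fun t : ℝ => (t : S1) := AddCircle.measurable_mk'
  have hmap : ν.map (fun y => (f y : S1)) = (ν.map f).map fun t : ℝ => (t : S1) :=
    (Measure.map_map hmk hfm).symm
  refine ⟨fun y => (f y : S1), hmk.comp hfm, fun x => ?_, ?_, ?_⟩
  · rw [hmap, Measure.map_apply hmk (measurableSet_singleton x)]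
    refine Countable.measure_zero ?_ _
    obtain ⟨r, rfl⟩ := QuotientAddGroup.mk_surjective x
    refine (countable_range fun n : ℤ => r + n).mono fun t ht => ?_
    obtain ⟨n, hn⟩ := exists_int_add_of_coe_eq ht
    exact ⟨n, hn.symm⟩
  · rw [hmap]
    exact measSupport_map_coe_eq_univ _ hcdf
  · have hf01 : ∀ᵐ y ∂ν, f y ∈ Ioo (0 : ℝ) 1 := by
      have h0 : ∀ᵐ y ∂ν, f y ≠ 0 := by simpa [ae_iff] using hatom 0
      have h1 : ∀ᵐ y ∂ν, f y ≠ 1 := by simpa [ae_iff] using hatom 1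
      filter_upwards [h0, h1] with y h0 h1
      exact ⟨lt_of_le_of_ne measureReal_nonneg h0.symm, lt_of_le_of_ne measureReal_le_one h1⟩
    have hpair : ∀ᵐ p ∂ν.prod ν, (f p.1 ∈ Ioo (0 : ℝ) 1 ∧ f p.2 ∈ Ioo (0 : ℝ) 1) ∧
        s p.1 p.2 = compareSign (f p.1) (f p.2) ∧ f p.1 ≠ f p.2 := by
      filter_upwards [Measure.quasiMeasurePreserving_fst.ae hf01,
        Measure.quasiMeasurePreserving_snd.ae hf01, ae_eq_compareSign hs hanti hx₀ htr]
        with p h1 h2 h3 using ⟨⟨h1, h2⟩, h3⟩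
    filter_upwards [ae_triple_of_ae_pair (P := fun y z =>
      (f y ∈ Ioo (0 : ℝ) 1 ∧ f z ∈ Ioo (0 : ℝ) 1) ∧ s y z = compareSign (f y) (f z) ∧ f y ≠ f z)
      hpair] with p hp
    obtain ⟨h12, h23, h13⟩ := hp
    rw [orient_coe h12.1.1 h12.1.2 h23.1.2 h12.2.2 h23.2.2 h13.2.2, hco, h12.2.1, h23.2.1,
      h13.2.1]

end
end
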